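/- Let G be a finite bipartite graph with weight function w and let M be an MCM of G. If M is a solution to the LexBAP for G, then M is also a solution to the SeqBAP for G. -/

import Mathlib

open Finset

variable {V : Type*} [Fintype V] [DecidableEq V]

/-- `M` is a matching: no vertex is incident to more than one edge of `M`. -/
def IsMatching (M : Finset (Sym2 V)) : Prop :=
  ∀ v : V, (M.filter (fun e => v ∈ e)).card ≤ 1

/-- `M` is a maximum cardinality matching of the graph with edge set `E`. -/
def IsMCM (E M : Finset (Sym2 V)) : Prop :=
  M ⊆ E ∧ IsMatching M ∧ ∀ M' ⊆ E, IsMatching M' → M'.card ≤ M.card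

/-- The cardinality of a maximum cardinality matching of `E`. -/
noncomputable def mcmCard (E : Finset (Sym2 V)) : ℕ :=
  sSup {k : ℕ | ∃ M ⊆ E, IsMatching M ∧ M.card = k}

/-- The largest weight of an edge of `M` (`max_{e ∈ M} w(e)`). -/
noncomputable def maxW (w : Sym2 V → ℝ) (M : Finset (Sym2 V)) : ℝ :=
  sSup (w '' (M : Set (Sym2 V)))

/-- The bottleneck weight `W(G) = min over MCMs M of max_{e ∈ M} w(e)`. -/
noncomputable def botW (w : Sym2 V → ℝ) (E : Finset (Sym2 V)) : ℝ :=
  sInf (maxW w '' {M : Finset (Sym2 V) | IsMCM E M})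

/-- `M` is a bottleneck assignment of `E`. -/
def IsBotAssignment (w : Sym2 V → ℝ) (E M : Finset (Sym2 V)) : Prop :=
  IsMCM E M ∧ maxW w M = botW w E

/-- Edge `e` has strictly positive price of absence in `E`. -/
def PosPrice (w : Sym2 V → ℝ) (E : Finset (Sym2 V)) (e : Sym2 V) : Prop :=
  mcmCard (E.erase e) < mcmCard E ∨ botW w E < botW w (E.erase e)

/-- The price of absence `P(G,e)` as an extended real (`⊤` if removing `e`
reduces the MCM cardinality). -/
noncomputable def price (w : Sym2 V → ℝ) (E : Finset (Sym2 V)) (e : Sym2 V) : EReal :=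
  if mcmCard (E.erase e) < mcmCard E then ⊤
  else ((botW w (E.erase e) - botW w E : ℝ) : EReal)

/-- `E` is the edge set of a bipartite graph on disjoint parts `A` and `B`. -/
def IsBipartiteOn (A B : Finset V) (E : Finset (Sym2 V)) : Prop :=
  Disjoint A B ∧ ∀ e ∈ E, ∃ a ∈ A, ∃ b ∈ B, e = s(a, b)

/-- `P` is a path between `x` and `y` all of whose edges lie in `E`. -/
def IsPathBetween (E P : Finset (Sym2 V)) (x y : V) : Prop :=
  ∃ (l : ℕ) (v : Fin (l + 1) → V), 0 < l ∧ Function.Injective v ∧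
    v 0 = x ∧ v (Fin.last l) = y ∧
    (∀ k : Fin l, s(v k.castSucc, v k.succ) ∈ E) ∧
    P = Finset.image (fun k : Fin l => s(v k.castSucc, v k.succ)) Finset.univ

/-- `P` is alternating relative to the matching `M`. -/
def IsAlternating (M P : Finset (Sym2 V)) : Prop :=
  ∀ v : V, ((P ∩ M).filter (fun e => v ∈ e)).card ≤ 1 ∧
    ((P \ M).filter (fun e => v ∈ e)).card ≤ 1

/-- Vertex `v` is free relative to the matching `M`. -/
def IsFree (M : Finset (Sym2 V)) (v : V) : Prop := ∀ e ∈ M, v ∉ e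

/-- `P` is an augmenting path relative to `M` contained in the edge set `E`. -/
def IsAugPath (E M P : Finset (Sym2 V)) : Prop :=
  ∃ x y : V, IsPathBetween E P x y ∧ IsAlternating M P ∧ IsFree M x ∧ IsFree M y

/-- The matching-sublevel set `ψ(G,M)`. -/
noncomputable def sublevel (w : Sym2 V → ℝ) (E M : Finset (Sym2 V)) : Finset (Sym2 V) :=
  E.filter (fun e => w e ≤ maxW w M)

/-- The strict matching-sublevel set `ψ_S(G,M)`. -/
noncomputable def strictSublevel (w : Sym2 V → ℝ) (E M : Finset (Sym2 V)) : Finset (Sym2 V) :=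
  E.filter (fun e => w e < maxW w M)

/-- `ec` is a critical bottleneck edge of `E` relative to the MCM `M`. -/
noncomputable def IsCritical (w : Sym2 V → ℝ) (E M : Finset (Sym2 V)) (ec : Sym2 V) : Prop :=
  ec ∈ M ∧ (∀ e ∈ M, w e ≤ w ec) ∧
  ¬ ∃ P, IsAugPath ((M ∪ strictSublevel w E M).erase ec) (M.erase ec) P

/-- The set `L(M)` of maximum-weight edges of `M`. -/
noncomputable def maxEdges (w : Sym2 V → ℝ) (M : Finset (Sym2 V)) : Finset (Sym2 V) :=
  M.filter (fun e => ∀ e' ∈ M, w e' ≤ w e)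

/-- The edge set of the subgraph of `E` induced by agent set `Ak` and task set `Bk`. -/
def induced (E : Finset (Sym2 V)) (Ak Bk : Finset V) : Finset (Sym2 V) :=
  E.filter (fun e => ∃ a ∈ Ak, ∃ b ∈ Bk, e = s(a, b))

/-- Witness data of a solution to the SeqBAP: selected edges `{i_k, j_k}`,
vertex sets `A^k`, `B^k` (0-indexed) and bottleneck assignments `M^k` of the
induced graphs `G^k`. -/
structure SeqBAPData (w : Sym2 V → ℝ) (A B : Finset V) (E : Finset (Sym2 V)) (n : ℕ) where
  i : Fin n → V
  j : Fin n → V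
  Ak : Fin n → Finset V
  Bk : Fin n → Finset V
  Mk : Fin n → Finset (Sym2 V)
  hij : ∀ k, i k ∈ A ∧ j k ∈ B
  hedsitinct : ∀ k l, s(i k, j k) = s(i l, j l) → k = l
  hA0 : ∀ h : 0 < n, Ak ⟨0, h⟩ = A
  hB0 : ∀ h : 0 < n, Bk ⟨0, h⟩ = B
  hAk : ∀ (k : ℕ) (h : k + 1 < n),
    Ak ⟨k + 1, h⟩ = (Ak ⟨k, by omega⟩).erase (i ⟨k, by omega⟩)
  hBk : ∀ (k : ℕ) (h : k + 1 < n),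
    Bk ⟨k + 1, h⟩ = (Bk ⟨k, by omega⟩).erase (j ⟨k, by omega⟩)
  hMk : ∀ k, IsBotAssignment w (induced E (Ak k) (Bk k)) (Mk k)
  hmaxedge : ∀ k, s(i k, j k) ∈ maxEdges w (Mk k)
  hprice : ∀ k, ∀ e ∈ maxEdges w (Mk k),
    price w (induced E (Ak k) (Bk k)) e ≤ price w (induced E (Ak k) (Bk k)) (s(i k, j k))

/-- `M` is a solution to the SeqBAP for the bipartite graph with parts `A`, `B`
and edge set `E`. -/
def IsSeqBAPSol (w : Sym2 V → ℝ) (A B : Finset V) (E M : Finset (Sym2 V)) : Prop :=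
  IsMCM E M ∧ ∃ (n : ℕ) (d : SeqBAPData w A B E n),
    M.card = n ∧ M = Finset.image (fun k => s(d.i k, d.j k)) Finset.univ

/-- The weights of `M` sorted in nonincreasing order (the tuple `T(M)`). -/
noncomputable def sortedW (w : Sym2 V → ℝ) (M : Finset (Sym2 V)) : List ℝ :=
  ((M.val.map w).sort (· ≤ ·)).reverse

/-- The `k`-th entry `T_k(M)` (0-indexed) of the sorted weight tuple. -/
noncomputable def Tk (w : Sym2 V → ℝ) (M : Finset (Sym2 V)) (k : ℕ) : ℝ :=
  (sortedW w M).getD k 0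

/-- `M` is a solution to the LexBAP for the graph with edge set `E`. -/
def IsLexBAPSol (w : Sym2 V → ℝ) (E M : Finset (Sym2 V)) : Prop :=
  IsMCM E M ∧ ∀ M', IsMCM E M' → sortedW w M' ≠ sortedW w M →
    ∃ k < M.card, Tk w M k < Tk w M' k ∧ ∀ l < k, Tk w M l = Tk w M' l

theorem isMatching_iff (M : Finset (Sym2 V)) :
    IsMatching M ↔ ∀ e ∈ M, ∀ f ∈ M, ∀ v, v ∈ e → v ∈ f → e = f := by
  unfold IsMatching
  simp only [Finset.card_le_one, Finset.mem_filter]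
  constructor
  · intro h e he f hf v hve hvf
    exact h v e ⟨he, hve⟩ f ⟨hf, hvf⟩
  · intro h v e he f hf
    exact h e he.1 f hf.1 v he.2 hf.2

theorem sortedW_pairwise (w : Sym2 V → ℝ) (M : Finset (Sym2 V)) :
    (sortedW w M).Pairwise (fun a b => b ≤ a) := by
  unfold sortedW
  rw [List.pairwise_reverse]
  exact Multiset.pairwise_sort _ _

theorem sortedW_coe (w : Sym2 V → ℝ) (M : Finset (Sym2 V)) :
    ((sortedW w M : List ℝ) : Multiset ℝ) = M.val.map w := by
  unfold sortedW
  rw [← Multiset.coe_reverse, List.reverse_reverse, Multiset.sort_eq]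

theorem mem_sortedW (w : Sym2 V → ℝ) (M : Finset (Sym2 V)) (x : ℝ) :
    x ∈ sortedW w M ↔ ∃ e ∈ M, w e = x := by
  rw [← Multiset.mem_coe, sortedW_coe]
  simp

theorem sortedW_length (w : Sym2 V → ℝ) (M : Finset (Sym2 V)) :
    (sortedW w M).length = M.card := by
  rw [← Multiset.coe_card, sortedW_coe]
  simp

theorem sortedW_union (w : Sym2 V → ℝ) (S N : Finset (Sym2 V)) (hd : Disjoint S N)
    (h : ∀ e ∈ S, ∀ f ∈ N, w f ≤ w e) :
    sortedW w (S ∪ N) = sortedW w S ++ sortedW w N := by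
  apply List.Perm.eq_of_pairwise (le := fun a b : ℝ => b ≤ a)
  · intro a b _ _ h1 h2
    exact le_antisymm h2 h1
  · exact sortedW_pairwise w _
  · rw [List.pairwise_append]
    refine ⟨sortedW_pairwise w _, sortedW_pairwise w _, ?_⟩
    intro a ha b hb
    obtain ⟨e, he, rfl⟩ := (mem_sortedW w S a).1 ha
    obtain ⟨f, hf, rfl⟩ := (mem_sortedW w N b).1 hb
    exact h e he f hf
  · rw [← Multiset.coe_eq_coe, ← Multiset.coe_add, sortedW_coe, sortedW_coe, sortedW_coe,
      ← Finset.disjUnion_eq_union _ _ hd, Finset.disjUnion_val, Multiset.map_add]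

/-- Replacing the light part of a lexicographic solution cannot lower its largest weight. -/
theorem lex_key (w : Sym2 V → ℝ) (E M S R N : Finset (Sym2 V)) (hlex : IsLexBAPSol w E M)
    (hM : M = S ∪ R) (hSR : Disjoint S R) (hSN : Disjoint S N) (hN : IsMCM E (S ∪ N))
    (hw : ∀ e ∈ S, ∀ f ∈ R, w f ≤ w e) (hcard : N.card = R.card)
    (e : Sym2 V) (he : e ∈ R) : ∃ f ∈ N, w e ≤ w f := by
  by_contra! hcon
  have h1 : sortedW w M = sortedW w S ++ sortedW w R := by
    rw [hM]; exact sortedW_union w S R hSR hw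
  have h2 : sortedW w (S ∪ N) = sortedW w S ++ sortedW w N :=
    sortedW_union w S N hSN (fun a ha f hf => (hcon f hf).le.trans (hw a ha e he))
  have hRpos : 0 < R.card := Finset.card_pos.2 ⟨e, he⟩
  have hlenR := sortedW_length w R
  have hlenN := sortedW_length w N
  have hlenS := sortedW_length w S
  have hR0 : w e ≤ (sortedW w R).getD 0 0 := by
    have hmem := (mem_sortedW w R (w e)).2 ⟨e, he, rfl⟩
    have hp := sortedW_pairwise w R
    cases hL : sortedW w R with
    | nil => rw [hL] at hmem; simp at hmem
    | cons x xs =>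
      rw [hL] at hmem hp
      rcases List.mem_cons.1 hmem with h | h
      · simp [h]
      · simpa using (List.pairwise_cons.1 hp).1 _ h
  have hN0 : (sortedW w N).getD 0 0 < w e := by
    cases hL : sortedW w N with
    | nil => rw [hL] at hlenN; simp at hlenN; omega
    | cons x xs =>
      obtain ⟨f, hf, hfx⟩ := (mem_sortedW w N x).1 (by rw [hL]; simp)
      have := hcon f hf
      simp only [List.getD_cons_zero]
      linarith
  have hMs : Tk w M S.card = (sortedW w R).getD 0 0 := by
    unfold Tk
    rw [h1, List.getD_append_right _ _ _ _ (by omega), hlenS, Nat.sub_self]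
  have hNs : Tk w (S ∪ N) S.card = (sortedW w N).getD 0 0 := by
    unfold Tk
    rw [h2, List.getD_append_right _ _ _ _ (by omega), hlenS, Nat.sub_self]
  have hne : sortedW w (S ∪ N) ≠ sortedW w M := by
    intro h
    have : Tk w (S ∪ N) S.card = Tk w M S.card := by unfold Tk; rw [h]
    linarith
  obtain ⟨k, _, hk, hl⟩ := hlex.2 _ hN hne
  rcases lt_trichotomy k S.card with h | h | h
  · have : Tk w M k = Tk w (S ∪ N) k := by
      unfold Tk
      rw [h1, h2, List.getD_append _ _ _ _ (by omega), List.getD_append _ _ _ _ (by omega)]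
    linarith
  · subst h; linarith
  · have := hl _ h; linarith

/-- Invariant of the sequential construction, for the set of edges remaining to be chosen. -/
structure SeqInv (w : Sym2 V → ℝ) (A B : Finset V) (E M : Finset (Sym2 V))
    (R : Finset (Sym2 V)) (A' B' : Finset V) : Prop where
  hA : A' ⊆ A
  hB : B' ⊆ B
  hRM : R ⊆ M
  hRE : R ⊆ induced E A' B'
  hout : ∀ e ∈ M, e ∉ R → ∀ v ∈ e, v ∉ A' ∧ v ∉ B'
  hw : ∀ e ∈ M, e ∉ R → ∀ f ∈ R, w f ≤ w e

theorem SeqInv.isBot {w : Sym2 V → ℝ} {A B : Finset V} {E M R : Finset (Sym2 V)}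
    {A' B' : Finset V} (h : SeqInv w A B E M R A' B') (hlex : IsLexBAPSol w E M)
    (hR : R.Nonempty) : IsBotAssignment w (induced E A' B') R := by
  obtain ⟨⟨hME, hMm, hMmax⟩, -⟩ := id hlex
  rw [isMatching_iff] at hMm
  have hU : M = (M \ R) ∪ R := (Finset.sdiff_union_of_subset h.hRM).symm
  have hcM : M.card = (M \ R).card + R.card := by
    have := Finset.card_sdiff_add_card_eq_card h.hRM; omega
  have key : ∀ N ⊆ induced E A' B', IsMatching N →
      Disjoint (M \ R) N ∧ (M \ R) ∪ N ⊆ E ∧ IsMatching ((M \ R) ∪ N) := by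
    intro N hN hNm
    rw [isMatching_iff] at hNm
    have hsep : ∀ e ∈ M \ R, ∀ f ∈ N, ∀ v, v ∈ e → v ∈ f → False := by
      intro e he f hf v hve hvf
      rw [Finset.mem_sdiff] at he
      have h1 := h.hout e he.1 he.2 v hve
      have h2 := hN hf
      simp only [induced, Finset.mem_filter] at h2
      obtain ⟨-, a, ha, b, hb, rfl⟩ := h2
      rcases Sym2.mem_iff.1 hvf with rfl | rfl
      · exact h1.1 ha
      · exact h1.2 hb
    refine ⟨?_, ?_, ?_⟩
    · rw [Finset.disjoint_left]
      intro e he heN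
      have h2 := hN heN
      simp only [induced, Finset.mem_filter] at h2
      obtain ⟨-, a, ha, b, hb, rfl⟩ := h2
      exact hsep _ he _ heN a (by simp) (by simp)
    · intro e he
      rcases Finset.mem_union.1 he with he | he
      · exact hME (Finset.mem_sdiff.1 he).1
      · exact (Finset.mem_filter.1 (hN he)).1
    · rw [isMatching_iff]
      intro e he f hf v hve hvf
      rcases Finset.mem_union.1 he with he | he <;> rcases Finset.mem_union.1 hf with hf | hf
      · exact hMm e (Finset.mem_sdiff.1 he).1 f (Finset.mem_sdiff.1 hf).1 v hve hvf
      · exact (hsep e he f hf v hve hvf).elim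
      · exact (hsep f hf e he v hvf hve).elim
      · exact hNm e he f hf v hve hvf
  have hRmcm : IsMCM (induced E A' B') R := by
    refine ⟨h.hRE, ?_, ?_⟩
    · rw [isMatching_iff]
      exact fun e he f hf => hMm e (h.hRM he) f (h.hRM hf)
    · intro N hN hNm
      obtain ⟨hd, hs, hm⟩ := key N hN hNm
      have := hMmax _ hs hm
      rw [Finset.card_union_of_disjoint hd] at this
      omega
  refine ⟨hRmcm, ?_⟩
  unfold botW
  apply le_antisymm
  · refine le_csInf ⟨maxW w R, R, hRmcm, rfl⟩ ?_
    rintro _ ⟨N, hN, rfl⟩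
    obtain ⟨hd, hs, hm⟩ := key N hN.1 hN.2.1
    have hc : N.card = R.card := le_antisymm (hRmcm.2.2 N hN.1 hN.2.1) (hN.2.2 R hRmcm.1 hRmcm.2.1)
    have hmcm : IsMCM E ((M \ R) ∪ N) := by
      refine ⟨hs, hm, fun M' h1 h2 => ?_⟩
      rw [Finset.card_union_of_disjoint hd, hc, ← hcM]
      exact hMmax M' h1 h2
    refine csSup_le ((Finset.coe_nonempty.2 hR).image w) ?_
    rintro _ ⟨e, he, rfl⟩
    obtain ⟨f, hf, hef⟩ := lex_key w E M (M \ R) R N hlex hU Finset.sdiff_disjoint hd hmcm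
      (fun e he f hf => h.hw e (Finset.mem_sdiff.1 he).1 (Finset.mem_sdiff.1 he).2 f hf) hc e he
    exact hef.trans (le_csSup (N.finite_toSet.image w).bddAbove ⟨f, hf, rfl⟩)
  · exact csInf_le ((Set.toFinite _).image _).bddBelow ⟨R, hRmcm, rfl⟩

theorem SeqInv.step {w : Sym2 V → ℝ} {A B : Finset V} {E M R : Finset (Sym2 V)}
    {A' B' : Finset V} (h : SeqInv w A B E M R A' B') (hAB : Disjoint A B)
    (hMm : IsMatching M) (hR : R.Nonempty) :
    ∃ p : V × V, p.1 ∈ A ∧ p.2 ∈ B ∧ s(p.1, p.2) ∈ maxEdges w R ∧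
      (∀ e ∈ maxEdges w R, price w (induced E A' B') e ≤
        price w (induced E A' B') s(p.1, p.2)) ∧
      SeqInv w A B E M (R.erase s(p.1, p.2)) (A'.erase p.1) (B'.erase p.2) := by
  rw [isMatching_iff] at hMm
  have hne : (maxEdges w R).Nonempty := by
    obtain ⟨e, he, hmax⟩ := Finset.exists_max_image R w hR
    exact ⟨e, Finset.mem_filter.2 ⟨he, hmax⟩⟩
  obtain ⟨e, he, hmax⟩ := Finset.exists_max_image _ (price w (induced E A' B')) hne
  obtain ⟨heR, hew⟩ := Finset.mem_filter.1 he
  have hE := h.hRE heR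
  simp only [induced, Finset.mem_filter] at hE
  obtain ⟨-, a, ha, b, hb, rfl⟩ := hE
  refine ⟨(a, b), h.hA ha, h.hB hb, he, hmax, ?_⟩
  refine ⟨(Finset.erase_subset _ _).trans h.hA, (Finset.erase_subset _ _).trans h.hB,
    (Finset.erase_subset _ _).trans h.hRM, ?_, ?_, ?_⟩
  · intro f hf
    obtain ⟨hfe, hfR⟩ := Finset.mem_erase.1 hf
    have h2 := h.hRE hfR
    simp only [induced, Finset.mem_filter] at h2 ⊢
    obtain ⟨hfE, a', ha', b', hb', rfl⟩ := h2
    refine ⟨hfE, a', Finset.mem_erase.2 ⟨?_, ha'⟩, b', Finset.mem_erase.2 ⟨?_, hb'⟩, rfl⟩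
    · rintro rfl
      exact hfe (hMm _ (h.hRM hfR) _ (h.hRM heR) a' (by simp) (by simp))
    · rintro rfl
      exact hfe (hMm _ (h.hRM hfR) _ (h.hRM heR) b' (by simp) (by simp))
  · intro f hf hfR v hv
    by_cases hfe : f = s(a, b)
    · subst hfe
      have hA := h.hA ha
      have hB := h.hB hb
      rcases Sym2.mem_iff.1 hv with rfl | rfl
      · exact ⟨by simp, fun hc => Finset.disjoint_left.1 hAB hA (h.hB (Finset.mem_of_mem_erase hc))⟩
      · exact ⟨fun hc => Finset.disjoint_left.1 hAB (h.hA (Finset.mem_of_mem_erase hc)) hB, by simp⟩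
    · have := h.hout f hf (fun hc => hfR (Finset.mem_erase.2 ⟨hfe, hc⟩)) v hv
      exact ⟨fun hc => this.1 (Finset.mem_of_mem_erase hc),
        fun hc => this.2 (Finset.mem_of_mem_erase hc)⟩
  · intro f hf hfR g hg
    have hgR := Finset.mem_of_mem_erase hg
    by_cases hfe : f = s(a, b)
    · subst hfe; exact hew g hgR
    · exact h.hw f hf (fun hc => hfR (Finset.mem_erase.2 ⟨hfe, hc⟩)) g hgR

/-- Every solution to the LexBAP is also a solution to the SeqBAP. -/
theorem lexBAP_sol_is_seqBAP_sol
    (A B : Finset V) (E : Finset (Sym2 V)) (w : Sym2 V → ℝ)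
    (hbip : IsBipartiteOn A B E)
    (M : Finset (Sym2 V)) (hMCM : IsMCM E M) (hlex : IsLexBAPSol w E M) :
    IsSeqBAPSol w A B E M := by
  classical
  have hinv0 : SeqInv w A B E M M A B := by
    refine ⟨subset_rfl, subset_rfl, subset_rfl, ?_, fun e h1 h2 => (h2 h1).elim,
      fun e h1 h2 => (h2 h1).elim⟩
    intro e he
    exact Finset.mem_filter.2 ⟨hMCM.1 he, hbip.2 e (hMCM.1 he)⟩
  refine ⟨hMCM, M.card, ?_⟩
  by_cases hM0 : M = ∅
  · subst hM0
    exact ⟨⟨fun k => k.elim0, fun k => k.elim0, fun k => k.elim0, fun k => k.elim0,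
      fun k => k.elim0, fun k => k.elim0, fun k => k.elim0, fun h => absurd h (lt_irrefl 0),
      fun h => absurd h (lt_irrefl 0), fun k h => absurd h (Nat.not_lt_zero _),
      fun k h => absurd h (Nat.not_lt_zero _), fun k => k.elim0, fun k => k.elim0,
      fun k => k.elim0⟩, rfl, by ext e; simp⟩
  haveI : Nonempty (V × V) := by
    obtain ⟨p, -⟩ := hinv0.step hbip.1 hMCM.2.1 (Finset.nonempty_iff_ne_empty.2 hM0)
    exact ⟨p⟩
  have hstep := fun (R : Finset (Sym2 V)) (A' B' : Finset V)
    (h : SeqInv w A B E M R A' B') (hR : R.Nonempty) => h.step hbip.1 hMCM.2.1 hR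
  choose! f hfA hfB hfm hfp hfi using hstep
  let st : ℕ → Finset (Sym2 V) × Finset V × Finset V := fun k =>
    Nat.rec (M, A, B) (fun _ s =>
      (s.1.erase s((f s.1 s.2.1 s.2.2).1, (f s.1 s.2.1 s.2.2).2),
        s.2.1.erase (f s.1 s.2.1 s.2.2).1, s.2.2.erase (f s.1 s.2.1 s.2.2).2)) k
  let p : ℕ → V × V := fun k => f (st k).1 (st k).2.1 (st k).2.2
  have hst : ∀ k, st (k + 1) = ((st k).1.erase s((p k).1, (p k).2),
      (st k).2.1.erase (p k).1, (st k).2.2.erase (p k).2) := fun k => rfl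
  have hI : ∀ k ≤ M.card, SeqInv w A B E M (st k).1 (st k).2.1 (st k).2.2 ∧
      (st k).1.card = M.card - k := by
    intro k
    induction k with
    | zero => exact fun _ => ⟨hinv0, rfl⟩
    | succ k ih =>
      intro hk
      obtain ⟨h1, h2⟩ := ih (by omega)
      have hne : (st k).1.Nonempty := Finset.card_pos.1 (by omega)
      refine ⟨hfi _ _ _ h1 hne, ?_⟩
      rw [hst]
      have hm := (Finset.mem_filter.1 (hfm _ _ _ h1 hne)).1
      have := Finset.card_erase_of_mem hm
      change ((st k).1.erase _).card = _
      rw [this]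
      omega
  have hN : ∀ k < M.card, (st k).1.Nonempty := fun k hk =>
    Finset.card_pos.1 (by have := (hI k hk.le).2; omega)
  have hmem : ∀ k < M.card, s((p k).1, (p k).2) ∈ (st k).1 := fun k hk =>
    (Finset.mem_filter.1 (hfm _ _ _ (hI k hk.le).1 (hN k hk))).1
  have hanti : Antitone (fun k => (st k).1) := by
    apply antitone_nat_of_succ_le
    intro k
    exact Finset.erase_subset _ _
  have hlt : ∀ k l, k < l → l < M.card → s((p k).1, (p k).2) ≠ s((p l).1, (p l).2) := by
    intro k l hkl hl heq
    have h1 := hanti (show k + 1 ≤ l from hkl) (hmem l hl)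
    rw [← heq] at h1
    exact Finset.notMem_erase _ _ h1
  have hdist : ∀ k l : Fin M.card, s((p k).1, (p k).2) = s((p l).1, (p l).2) → k = l := by
    intro k l h
    rcases lt_trichotomy k l with hkl | hkl | hkl
    · exact (hlt k l hkl l.2 h).elim
    · exact hkl
    · exact (hlt l k hkl k.2 h.symm).elim
  refine ⟨⟨fun k => (p k).1, fun k => (p k).2, fun k => (st k).2.1, fun k => (st k).2.2,
    fun k => (st k).1, ?_, hdist, fun _ => rfl, fun _ => rfl, fun _ _ => rfl, fun _ _ => rfl,
    ?_, ?_, ?_⟩, rfl, ?_⟩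
  · intro k
    exact ⟨hfA _ _ _ (hI k k.2.le).1 (hN k k.2), hfB _ _ _ (hI k k.2.le).1 (hN k k.2)⟩
  · intro k
    exact (hI k k.2.le).1.isBot hlex (hN k k.2)
  · intro k
    exact hfm _ _ _ (hI k k.2.le).1 (hN k k.2)
  · intro k
    exact hfp _ _ _ (hI k k.2.le).1 (hN k k.2)
  · symm
    apply Finset.eq_of_subset_of_card_le
    · intro e he
      obtain ⟨k, -, rfl⟩ := Finset.mem_image.1 he
      exact (hI k k.2.le).1.hRM (hmem k k.2)
    · rw [Finset.card_image_of_injective _ (fun k l h => hdist k l h)]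
      simp
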